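/- arXiv:2403.17825 — 4 statements merged into one kernel-verified Lean document; each statement's English description precedes it below -/
import Mathlib

section
/- Let 𝒜 be an abelian category and (F_i : 𝒜 → ℬ_i)_{i ∈ ι} a nonempty family of exact functors into abelian categories. Let I = ⋂_{i ∈ ι} Ker F_i (a Serre subcategory of 𝒜), let π : 𝒜 → 𝒜/I be the quotient functor, for each i let r_i : 𝒜/I → ℬ_i be the exact functor induced by F_i (r_i ∘ π ≅ F_i), and let p_i : 𝒜/I → 𝒜/Ker F_i be the exact functor induced by the quotient of 𝒜 by Ker F_i. Then the following are equivalent: (a) Ker F_i = Ker F_j for all i, j ∈ ι; (b) r_i is faithful for every i ∈ ι; (c) p_i is an equivalence of categories for every i ∈ ι. -/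
open CategoryTheory CategoryTheory.Limits

/-- The class of morphisms of an abelian category whose kernel and cokernel both
satisfy `P`.  For a Serre class `P`, the Serre quotient `𝒜/P` is the localization of
`𝒜` at this class of morphisms. -/
def serreW {𝒜 : Type*} [Category 𝒜] [Abelian 𝒜] (P : 𝒜 → Prop) :
    MorphismProperty 𝒜 :=
  fun _ _ f => P (kernel f) ∧ P (cokernel f)

namespace CategoryTheory

lemma ObjectProperty.isSerreClass_forall {C ι : Type*} [Category C] [Abelian C]
    (P : ι → ObjectProperty C) [∀ i, (P i).IsSerreClass] :
    ObjectProperty.IsSerreClass (fun X ↦ ∀ i, P i X) where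
  exists_zero := ⟨_, isZero_zero C, fun i ↦ (P i).prop_zero⟩
  prop_of_mono f _ h i := (P i).prop_of_mono f (h i)
  prop_of_epi f _ h i := (P i).prop_of_epi f (h i)
  prop_X₂_of_shortExact hS h₁ h₃ i := (P i).prop_X₂_of_shortExact hS (h₁ i) (h₃ i)

variable {C D : Type*} [Category C] [Category D] [Abelian C] [Abelian D]

lemma isZero_obj_iff_of_isLocalization_serreW (P : ObjectProperty C) [P.IsSerreClass]
    (L : C ⥤ D) [L.Additive] [hL : L.IsLocalization (serreW P)] (X : C) :
    IsZero (L.obj X) ↔ P X :=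
  have : L.IsLocalization P.isoModSerre := hL
  ObjectProperty.SerreClassLocalization.isZero_obj_iff L P X

namespace Functor

lemma isSerreClass_isZero_obj (F : C ⥤ D) [PreservesFiniteLimits F]
    [PreservesFiniteColimits F] :
    ObjectProperty.IsSerreClass (fun X ↦ IsZero (F.obj X)) :=
  inferInstanceAs (ObjectProperty.inverseImage (IsZero (C := D)) F).IsSerreClass

lemma isZero_of_isZero_obj_of_faithful (F : C ⥤ D) [F.PreservesZeroMorphisms] [F.Faithful]
    {X : C} (h : IsZero (F.obj X)) : IsZero X := by
  rw [IsZero.iff_id_eq_zero] at h ⊢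
  exact F.map_injective (by simpa using h)

lemma faithful_of_isZero_of_isZero_obj (F : C ⥤ D) [F.Additive]
    [PreservesFiniteLimits F] [PreservesFiniteColimits F]
    (hF : ∀ X, IsZero (F.obj X) → IsZero X) : F.Faithful := by
  have key : ∀ {X Y : C} (f : X ⟶ Y), F.map f = 0 → f = 0 := by
    intro X Y f hf
    have h : F.map (factorThruImage f) ≫ F.map (image.ι f) = 0 := by
      rw [← F.map_comp, image.fac, hf]
    have hι : F.map (image.ι f) = 0 := by
      rwa [← cancel_epi (F.map (factorThruImage f)), comp_zero]
    have hI := hF _ (IsZero.of_mono_eq_zero _ hι)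
    rw [← image.fac f, hI.eq_of_src (image.ι f) 0, comp_zero]
  exact ⟨fun {X Y f g} h ↦ sub_eq_zero.1 (key _ (by rw [F.map_sub, h, sub_self]))⟩

end Functor

end CategoryTheory

/-- Let `(Fᵢ : 𝒜 ⥤ ℬᵢ)` be a nonempty family of exact functors between abelian
categories, `I = ⋂ᵢ Ker Fᵢ`, `π : 𝒜 ⥤ 𝒟` the exact quotient functor to the Serre
quotient `𝒜/I`, `rᵢ : 𝒟 ⥤ ℬᵢ` the exact functor induced by `Fᵢ` (so `rᵢ ∘ π ≅ Fᵢ`),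
and `pᵢ : 𝒟 ⥤ 𝒟ᵢ` the exact functor induced by the quotient functor
`πᵢ : 𝒜 ⥤ 𝒟ᵢ = 𝒜/Ker Fᵢ` (so `pᵢ ∘ π ≅ πᵢ`).  Then the following are equivalent:
(a) `Ker Fᵢ = Ker Fⱼ` for all `i, j`; (b) every `rᵢ` is faithful; (c) every `pᵢ` is an
equivalence of categories. -/
theorem serre_quotient_family_tfae
    {ι : Type*} [Nonempty ι]
    {𝒜 𝒟 : Type*} [Category 𝒜] [Category 𝒟] [Abelian 𝒜] [Abelian 𝒟]
    {ℬ : ι → Type*} [∀ i, Category (ℬ i)] [∀ i, Abelian (ℬ i)]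
    {𝒟' : ι → Type*} [∀ i, Category (𝒟' i)] [∀ i, Abelian (𝒟' i)]
    (F : ∀ i, 𝒜 ⥤ ℬ i) [∀ i, (F i).Additive]
    [∀ i, PreservesFiniteLimits (F i)] [∀ i, PreservesFiniteColimits (F i)]
    (π : 𝒜 ⥤ 𝒟) [π.Additive] [PreservesFiniteLimits π] [PreservesFiniteColimits π]
    [π.IsLocalization (serreW (fun X : 𝒜 => ∀ i, IsZero ((F i).obj X)))]
    (π' : ∀ i, 𝒜 ⥤ 𝒟' i) [∀ i, (π' i).Additive]
    [∀ i, PreservesFiniteLimits (π' i)] [∀ i, PreservesFiniteColimits (π' i)]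
    [∀ i, (π' i).IsLocalization (serreW (fun X : 𝒜 => IsZero ((F i).obj X)))]
    (r : ∀ i, 𝒟 ⥤ ℬ i) [∀ i, (r i).Additive]
    [∀ i, PreservesFiniteLimits (r i)] [∀ i, PreservesFiniteColimits (r i)]
    (er : ∀ i, π ⋙ r i ≅ F i)
    (p : ∀ i, 𝒟 ⥤ 𝒟' i) [∀ i, (p i).Additive]
    [∀ i, PreservesFiniteLimits (p i)] [∀ i, PreservesFiniteColimits (p i)]
    (ep : ∀ i, π ⋙ p i ≅ π' i) :
    ((∀ i j, ∀ X : 𝒜, IsZero ((F i).obj X) ↔ IsZero ((F j).obj X)) ↔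
        (∀ i, (r i).Faithful)) ∧
    ((∀ i, (r i).Faithful) ↔ (∀ i, (p i).IsEquivalence)) := by
  have hker i := (F i).isSerreClass_isZero_obj
  have := ObjectProperty.isSerreClass_forall (fun i X ↦ IsZero ((F i).obj X))
  have hπ (X : 𝒜) : IsZero (π.obj X) ↔ ∀ i, IsZero ((F i).obj X) :=
    isZero_obj_iff_of_isLocalization_serreW (fun X ↦ ∀ i, IsZero ((F i).obj X)) π X
  have hπ' (i) (X : 𝒜) : IsZero ((π' i).obj X) ↔ IsZero ((F i).obj X) :=
    isZero_obj_iff_of_isLocalization_serreW (fun X ↦ IsZero ((F i).obj X)) (π' i) X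
  have ha : (∀ i j, ∀ X : 𝒜, IsZero ((F i).obj X) ↔ IsZero ((F j).obj X)) ↔
      ∀ i, ∀ X : 𝒜, IsZero ((F i).obj X) → IsZero (π.obj X) :=
    ⟨fun h i X hX ↦ (hπ X).2 fun j ↦ (h i j X).1 hX,
      fun h i j X ↦ ⟨fun hX ↦ (hπ X).1 (h i X hX) j, fun hX ↦ (hπ X).1 (h j X hX) i⟩⟩
  have hb (i) : (∀ X : 𝒜, IsZero ((F i).obj X) → IsZero (π.obj X)) ↔ (r i).Faithful := by
    refine ⟨fun h ↦ (r i).faithful_of_isZero_of_isZero_obj fun Y hY ↦ ?_, fun _ X hX ↦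
      (r i).isZero_of_isZero_obj_of_faithful (((er i).app X).isZero_iff.2 hX)⟩
    have := Localization.essSurj π (serreW (fun X : 𝒜 => ∀ i, IsZero ((F i).obj X)))
    let e := π.objObjPreimageIso Y
    exact e.isZero_iff.1 (h _ (((er i).app _).isZero_iff.1
      (((r i).mapIso e).isZero_iff.2 hY)))
  have hc (i) : (∀ X : 𝒜, IsZero ((F i).obj X) → IsZero (π.obj X)) ↔
      (p i).IsEquivalence := by
    refine ⟨fun h ↦ ?_, fun _ X hX ↦ (p i).isZero_of_isZero_obj_of_faithful
      (((ep i).app X).isZero_iff.2 ((hπ' i X).2 hX))⟩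
    have hP : (fun X : 𝒜 ↦ ∀ i, IsZero ((F i).obj X)) = fun X ↦ IsZero ((F i).obj X) :=
      funext fun X ↦ propext ⟨fun hX ↦ hX i, fun hX ↦ (hπ X).1 (h X hX)⟩
    have : π.IsLocalization (serreW (fun X : 𝒜 ↦ IsZero ((F i).obj X))) := by
      rw [← hP]; infer_instance
    exact Functor.isEquivalence_of_iso (Localization.isoUniqFunctor π (π' i)
      (serreW (fun X : 𝒜 ↦ IsZero ((F i).obj X))) (p i) (ep i)).symm
  exact ⟨ha.trans (forall_congr' hb), forall_congr' fun i ↦ (hb i).symm.trans (hc i)⟩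
end

section
/- Let 𝒜, ℬ, ℬ', 𝒞 be abelian categories, F : 𝒜 → ℬ and F' : 𝒜 → ℬ' exact functors, and G : ℬ → 𝒞 and G' : ℬ' → 𝒞 faithful exact functors, together with a natural isomorphism G ∘ F ≅ G' ∘ F'. Then Ker F = Ker F': an object X of 𝒜 satisfies F(X) ≅ 0 if and only if F'(X) ≅ 0. -/
open CategoryTheory CategoryTheory.Limits

/-- A faithful functor preserving zero morphisms preserves and reflects zero objects. -/
theorem CategoryTheory.Functor.isZero_obj_iff_of_faithful
    {C D : Type*} [Category C] [Category D] [HasZeroMorphisms C] [HasZeroMorphisms D]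
    (G : C ⥤ D) [G.PreservesZeroMorphisms] [G.Faithful] (Y : C) :
    IsZero (G.obj Y) ↔ IsZero Y := by
  rw [IsZero.iff_id_eq_zero, IsZero.iff_id_eq_zero, ← G.map_id, G.map_eq_zero_iff]

/-- Let `F : 𝒜 ⥤ ℬ` and `F' : 𝒜 ⥤ ℬ'` be exact functors between abelian categories,
`G : ℬ ⥤ 𝒞` and `G' : ℬ' ⥤ 𝒞` faithful exact functors, together with a natural
isomorphism `G ∘ F ≅ G' ∘ F'` (a comparison isomorphism).  Then `Ker F = Ker F'`:
an object `X` of `𝒜` satisfies `F(X) ≅ 0` if and only if `F'(X) ≅ 0`.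
(In the paper's terminology: comparable cohomology theories are equivalent.) -/
theorem kernels_eq_of_comparison
    {𝒜 ℬ ℬ' 𝒞 : Type*} [Category 𝒜] [Category ℬ] [Category ℬ'] [Category 𝒞]
    [Abelian 𝒜] [Abelian ℬ] [Abelian ℬ'] [Abelian 𝒞]
    (F : 𝒜 ⥤ ℬ) [F.Additive] [PreservesFiniteLimits F] [PreservesFiniteColimits F]
    (F' : 𝒜 ⥤ ℬ') [F'.Additive] [PreservesFiniteLimits F'] [PreservesFiniteColimits F']
    (G : ℬ ⥤ 𝒞) [G.Faithful] [G.Additive]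
    [PreservesFiniteLimits G] [PreservesFiniteColimits G]
    (G' : ℬ' ⥤ 𝒞) [G'.Faithful] [G'.Additive]
    [PreservesFiniteLimits G'] [PreservesFiniteColimits G']
    (comparison : F ⋙ G ≅ F' ⋙ G') :
    ∀ X : 𝒜, IsZero (F.obj X) ↔ IsZero (F'.obj X) := by
  intro X
  rw [← G.isZero_obj_iff_of_faithful, ← G'.isZero_obj_iff_of_faithful]
  exact (comparison.app X).isZero_iff
end

section
/- Let 𝒜 and ℬ be abelian rigid symmetric monoidal ℚ-linear categories (so the tensor products are exact), suppose the endomorphism ring End_𝒜(1) of the unit object of 𝒜 is a field, and suppose ℬ is nonzero (the unit object of ℬ is not a zero object). Then every exact strong symmetric monoidal ℚ-linear functor G : 𝒜 → ℬ is faithful. -/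
open CategoryTheory CategoryTheory.Limits MonoidalCategory

namespace CategoryTheory

/-- An exact functor between abelian categories that reflects zero objects is faithful. -/
lemma Functor.faithful_of_isZero_of_isZero_obj_s11 {C D : Type*} [Category* C] [Category* D]
    [Abelian C] [Abelian D]
    (G : C ⥤ D) [G.Additive] [PreservesFiniteLimits G] [PreservesFiniteColimits G]
    (h : ∀ X, IsZero (G.obj X) → IsZero X) : G.Faithful := by
  have map_eq_zero {X Y : C} (f : X ⟶ Y) (hf : G.map f = 0) : f = 0 := by
    have hι : G.map (image.ι f) = 0 := by
      rw [← cancel_epi (G.map (factorThruImage f)), ← G.map_comp, image.fac, hf, comp_zero]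
    rw [← image.fac f, (h _ (IsZero.of_mono_eq_zero _ hι)).eq_of_src (image.ι f) 0, comp_zero]
  exact ⟨fun {X Y f g} hfg ↦ sub_eq_zero.1 (map_eq_zero _ (by rw [G.map_sub, hfg, sub_self]))⟩

section Preadditive

variable {C : Type*} [Category* C] [Preadditive C] [MonoidalCategory C] [MonoidalPreadditive C]

lemma isZero_tensor_left {X : C} (hX : IsZero X) (Y : C) : IsZero (X ⊗ Y) :=
  (tensorRight Y).map_isZero hX

lemma isZero_tensor_right (X : C) {Y : C} (hY : IsZero Y) : IsZero (X ⊗ Y) :=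
  (tensorLeft X).map_isZero hY

lemma isZero_of_coevaluation_eq_zero (X Y : C) [ExactPairing X Y] (h : η_ X Y = 0) :
    IsZero X := by
  have h' := ExactPairing.evaluation_coevaluation X Y
  rw [h, MonoidalPreadditive.zero_whiskerRight, zero_comp] at h'
  rw [IsZero.iff_id_eq_zero]
  calc 𝟙 X = (λ_ X).inv ≫ ((λ_ X).hom ≫ (ρ_ X).inv) ≫ (ρ_ X).hom := by simp
    _ = 0 := by rw [← h', zero_comp, comp_zero]

lemma isZero_of_evaluation_eq_zero (X Y : C) [ExactPairing X Y] (h : ε_ X Y = 0) :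
    IsZero X := by
  have h' := ExactPairing.evaluation_coevaluation X Y
  rw [h, MonoidalPreadditive.whiskerLeft_zero, comp_zero, comp_zero] at h'
  rw [IsZero.iff_id_eq_zero]
  calc 𝟙 X = (λ_ X).inv ≫ ((λ_ X).hom ≫ (ρ_ X).inv) ≫ (ρ_ X).hom := by simp
    _ = 0 := by rw [← h', zero_comp, comp_zero]

lemma isZero_tensor_dual [BraidedCategory C] {X V D : C} [ExactPairing V D]
    (h : IsZero (X ⊗ V)) : IsZero (X ⊗ D) := by
  have hV : IsZero (V ⊗ D ⊗ X) :=
    (isZero_tensor_right D h).of_iso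
      ((α_ V D X).symm ≪≫ whiskerRightIso (β_ V D) X ≪≫ α_ D V X ≪≫ whiskerLeftIso D (β_ V X))
  refine IsZero.of_iso ?_ (β_ X D)
  rw [IsZero.iff_id_eq_zero]
  exact (tensorLeftHomEquiv X V D (D ⊗ X)).injective (hV.eq_of_tgt _ _)

/-- If the evaluation of `X` vanishes in a quotient `V` of the unit, then `X ⊗ V` is zero: the
evaluation becomes a split epimorphism after tensoring with `X`. -/
lemma isZero_tensor_of_evaluation_comp_eq_zero {X Y V : C} [ExactPairing X Y] [HasLeftDual X]
    (q : 𝟙_ C ⟶ V) [Epi q] (h : ε_ X Y ≫ q = 0) : IsZero (X ⊗ V) := by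
  have : (tensorLeft X).IsLeftAdjoint := (tensorLeftAdjunction (ᘁX) X).isLeftAdjoint
  have : Epi (X ◁ q) := inferInstanceAs (Epi ((tensorLeft X).map q))
  have : Epi (X ◁ ε_ X Y) := by
    have h' := ExactPairing.evaluation_coevaluation X Y
    rw [← Category.assoc] at h'
    exact epi_of_epi_fac h'
  have hq : X ◁ q = 0 := by
    rw [← cancel_epi (X ◁ ε_ X Y), ← MonoidalCategory.whiskerLeft_comp, h,
      MonoidalPreadditive.whiskerLeft_zero, comp_zero]
  exact IsZero.of_epi_eq_zero _ hq

end Preadditive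

section Abelian

variable {C : Type*} [Category* C] [Abelian C] [MonoidalCategory C] [MonoidalPreadditive C]

lemma isIso_cokernel_π_whiskerRight {A B : C} (f : A ⟶ B) (D : C) [HasRightDual D]
    (h : IsZero (A ⊗ D)) : IsIso (cokernel.π f ▷ D) := by
  have : (tensorRight D).IsLeftAdjoint := (tensorRightAdjunction D (Dᘁ)).isLeftAdjoint
  have : Epi (cokernel.π f ▷ D) := inferInstanceAs (Epi ((tensorRight D).map (cokernel.π f)))
  have hf : (tensorRight D).map f = 0 := h.eq_of_src _ _
  have hS := (ShortComplex.exact_cokernel f).map_of_epi_of_preservesCokernel (tensorRight D)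
    inferInstance inferInstance
  have : Mono (cokernel.π f ▷ D) := hS.mono_g hf
  exact isIso_of_mono_of_epi _

/-- If the endomorphisms of the unit form a field, evaluations of nonzero objects are
epimorphisms. -/
lemma epi_evaluation_of_isField_end_unit [BraidedCategory C] [RigidCategory C]
    (hC : IsField (End (𝟙_ C))) {X : C} (hX : ¬ IsZero X) : Epi (ε_ X (Xᘁ)) := by
  set e := ε_ X (Xᘁ)
  set V := cokernel e
  set q : 𝟙_ C ⟶ V := cokernel.π e
  apply Preadditive.epi_of_isZero_cokernel
  by_contra hV
  have hXD : IsZero (X ⊗ Vᘁ) :=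
    isZero_tensor_dual (isZero_tensor_of_evaluation_comp_eq_zero q (cokernel.condition e))
  have : IsIso (q ▷ Vᘁ) := isIso_cokernel_π_whiskerRight e (Vᘁ)
    ((isZero_tensor_right (Xᘁ) hXD).of_iso (α_ _ _ _))
  have hs : ∃ s : V ⟶ 𝟙_ C, s ≠ 0 := by
    by_contra! hs
    refine hV (isZero_of_coevaluation_eq_zero V (Vᘁ) ?_)
    rw [← cancel_mono (inv (q ▷ Vᘁ)), zero_comp]
    apply (tensorRightHomEquiv (𝟙_ C) V (Vᘁ) (𝟙_ C)).symm.injective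
    rw [← cancel_epi (λ_ V).inv, hs (_ ≫ _), hs (_ ≫ _)]
  obtain ⟨s, hs⟩ := hs
  have hc : q ≫ s ≠ 0 := fun h ↦ hs ((cancel_epi q).1 (h.trans comp_zero.symm))
  obtain ⟨b, hb⟩ := hC.mul_inv_cancel (a := (q ≫ s : End (𝟙_ C))) hc
  have hb' : (q ≫ s) ≫ b = 𝟙 _ := by
    rw [hC.mul_comm] at hb
    exact hb
  refine hX (isZero_of_evaluation_eq_zero X (Xᘁ) ?_)
  change e = 0
  rw [← Category.comp_id e, ← hb', Category.assoc, cokernel.condition_assoc, zero_comp]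

end Abelian

end CategoryTheory

/-- Let `𝒜` and `ℬ` be abelian rigid symmetric monoidal `ℚ`-linear categories (tensor
product additive and `ℚ`-linear in each variable; rigidity makes it exact), suppose the
endomorphism ring `End(𝟙_𝒜)` of the unit object of `𝒜` is a field, and suppose `ℬ` is
nonzero (its unit object is not a zero object).  Then every exact strong symmetric
monoidal `ℚ`-linear functor `G : 𝒜 ⥤ ℬ` is faithful. -/
theorem exact_tensor_functor_faithful_of_isField_end_unit
    {𝒜 ℬ : Type*} [Category 𝒜] [Category ℬ] [Abelian 𝒜] [Abelian ℬ]
    [CategoryTheory.Linear ℚ 𝒜] [CategoryTheory.Linear ℚ ℬ]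
    [MonoidalCategory 𝒜] [MonoidalCategory ℬ]
    [SymmetricCategory 𝒜] [SymmetricCategory ℬ]
    [RigidCategory 𝒜] [RigidCategory ℬ]
    [MonoidalPreadditive 𝒜] [MonoidalPreadditive ℬ]
    [MonoidalLinear ℚ 𝒜] [MonoidalLinear ℚ ℬ]
    (hfield : IsField (End (𝟙_ 𝒜)))
    (hB : ¬ IsZero (𝟙_ ℬ))
    (G : 𝒜 ⥤ ℬ) [G.Additive] [G.Linear ℚ]
    [PreservesFiniteLimits G] [PreservesFiniteColimits G]
    [G.Braided] :
    G.Faithful := by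
  refine G.faithful_of_isZero_of_isZero_obj_s11 fun X hGX ↦ ?_
  by_contra hX
  have := epi_evaluation_of_isField_end_unit hfield hX
  have hG : IsZero (G.obj (Xᘁ ⊗ X)) :=
    (isZero_tensor_right (G.obj (Xᘁ)) hGX).of_iso (Functor.Monoidal.μIso G _ _).symm
  exact hB ((IsZero.of_epi (G.map (ε_ X (Xᘁ))) hG).of_iso (Functor.Monoidal.εIso G))
end

section
/- Let 𝒜 be an abelian rigid symmetric monoidal category. Then the endomorphism ring Z(𝒜) := End_𝒜(1) of the unit object is a commutative ring which is von Neumann regular (absolutely flat): for every a ∈ End_𝒜(1) there exists x ∈ End_𝒜(1) with a·x·a = a. In particular, if End_𝒜(1) is an integral domain then it is a field. -/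
open CategoryTheory CategoryTheory.Limits MonoidalCategory

section

variable {C : Type*} [Category C] [MonoidalCategory C]

theorem CategoryTheory.MonoidalCategory.isLeftAdjoint_tensorLeft (X : C) [HasLeftDual X] :
    (tensorLeft X).IsLeftAdjoint :=
  (tensorLeftAdjunction (ᘁX) X).isLeftAdjoint

theorem CategoryTheory.MonoidalCategory.isRightAdjoint_tensorLeft (X : C) [HasRightDual X] :
    (tensorLeft X).IsRightAdjoint :=
  (tensorLeftAdjunction X (Xᘁ)).isRightAdjoint

theorem CategoryTheory.MonoidalCategory.isLeftAdjoint_tensorRight (X : C) [HasRightDual X] :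
    (tensorRight X).IsLeftAdjoint :=
  (tensorRightAdjunction X (Xᘁ)).isLeftAdjoint

theorem CategoryTheory.MonoidalCategory.isRightAdjoint_tensorRight (X : C) [HasLeftDual X] :
    (tensorRight X).IsRightAdjoint :=
  (tensorRightAdjunction (ᘁX) X).isRightAdjoint

theorem CategoryTheory.MonoidalCategory.leftUnitor_inv_whiskerRight_leftUnitor_hom_comp
    {X : C} (a : 𝟙_ C ⟶ 𝟙_ C) (m : X ⟶ 𝟙_ C) :
    (λ_ X).inv ≫ a ▷ X ≫ (λ_ X).hom ≫ m = m ≫ a := by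
  rw [← leftUnitor_naturality, ← whisker_exchange_assoc, ← leftUnitor_inv_naturality_assoc]
  simp [unitors_equal, unitors_inv_equal]

theorem CategoryTheory.MonoidalCategory.end_unit_comp_comm (a b : 𝟙_ C ⟶ 𝟙_ C) :
    a ≫ b = b ≫ a := by
  rw [← leftUnitor_inv_whiskerRight_leftUnitor_hom_comp b a]
  simp [unitors_equal, unitors_inv_equal]

variable [Abelian C] [RigidCategory C]

/-- Right tensoring by a quotient of the unit makes the quotient map a monomorphism. -/
theorem CategoryTheory.MonoidalCategory.mono_whiskerRight_of_epi
    {I : C} (e : 𝟙_ C ⟶ I) [Epi e] : Mono (e ▷ I) := by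
  have := isLeftAdjoint_tensorRight I
  have := isRightAdjoint_tensorRight I
  have := isLeftAdjoint_tensorLeft (kernel e)
  have : (tensorRight I).PreservesZeroMorphisms :=
    Functor.preservesZeroMorphisms_of_isLeftAdjoint _
  have hepi : Epi (kernel e ◁ e) := inferInstanceAs (Epi ((tensorLeft (kernel e)).map e))
  have hz : kernel.ι e ▷ I = 0 := by
    rw [← cancel_epi (kernel e ◁ e), whisker_exchange, comp_zero]
    simp [unitors_equal]
  have hS : (ShortComplex.mk _ _ (kernel.condition e)).Exact :=
    ShortComplex.exact_of_f_is_kernel _ (kernelIsKernel e)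
  exact (hS.map (tensorRight I)).mono_g hz

/-- Right tensoring by a subobject of the unit makes the inclusion an epimorphism. -/
theorem CategoryTheory.MonoidalCategory.epi_whiskerRight_of_mono
    {I : C} (m : I ⟶ 𝟙_ C) [Mono m] : Epi (m ▷ I) := by
  have := isLeftAdjoint_tensorRight I
  have := isRightAdjoint_tensorRight I
  have := isRightAdjoint_tensorLeft (cokernel m)
  have : (tensorRight I).PreservesZeroMorphisms :=
    Functor.preservesZeroMorphisms_of_isLeftAdjoint _
  have hmono : Mono (cokernel m ◁ m) := inferInstanceAs (Mono ((tensorLeft (cokernel m)).map m))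
  have hz : cokernel.π m ▷ I = 0 := by
    rw [← cancel_mono (cokernel m ◁ m), ← whisker_exchange, zero_comp]
    simp [unitors_inv_equal]
  have hS : (ShortComplex.mk _ _ (cokernel.condition m)).Exact :=
    ShortComplex.exact_of_g_is_cokernel _ (cokernelIsCokernel m)
  exact (hS.map (tensorRight I)).epi_f hz

theorem CategoryTheory.MonoidalCategory.isIso_comp_of_mono_of_epi
    {I : C} (e : 𝟙_ C ⟶ I) (m : I ⟶ 𝟙_ C) [Epi e] [Mono m] : IsIso (m ≫ e) := by
  have := isLeftAdjoint_tensorRight I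
  have := isRightAdjoint_tensorRight I
  have := mono_whiskerRight_of_epi e
  have := epi_whiskerRight_of_mono m
  have : Epi (e ▷ I) := inferInstanceAs (Epi ((tensorRight I).map e))
  have : Mono (m ▷ I) := inferInstanceAs (Mono ((tensorRight I).map m))
  have : IsIso (e ▷ I) := isIso_of_mono_of_epi _
  have : IsIso (m ▷ I) := isIso_of_mono_of_epi _
  have h : m ≫ e = (λ_ I).inv ≫ (e ▷ I ≫ m ▷ I) ≫ (λ_ I).hom := by
    rw [← cancel_mono m, ← comp_whiskerRight]
    simpa using (leftUnitor_inv_whiskerRight_leftUnitor_hom_comp (e ≫ m) m).symm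
  rw [h]
  infer_instance

theorem CategoryTheory.MonoidalCategory.exists_comp_comp_eq_of_end_unit (a : 𝟙_ C ⟶ 𝟙_ C) :
    ∃ x : 𝟙_ C ⟶ 𝟙_ C, a ≫ x ≫ a = a := by
  let e := Abelian.factorThruImage a
  let m := Abelian.image.ι a
  have hem : e ≫ m = a := Abelian.image.fac a
  have := isIso_comp_of_mono_of_epi e m
  refine ⟨e ≫ inv (m ≫ e) ≫ inv (m ≫ e) ≫ m, ?_⟩
  have h : (m ≫ e) ≫ inv (m ≫ e) ≫ inv (m ≫ e) ≫ m ≫ e = 𝟙 _ := by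
    rw [IsIso.hom_inv_id_assoc, IsIso.inv_hom_id]
  calc a ≫ (e ≫ inv (m ≫ e) ≫ inv (m ≫ e) ≫ m) ≫ a
      = e ≫ ((m ≫ e) ≫ inv (m ≫ e) ≫ inv (m ≫ e) ≫ m ≫ e) ≫ m := by
        simp only [← hem, Category.assoc]
    _ = a := by rw [h, Category.id_comp, hem]

end

/-- In an abelian rigid symmetric monoidal category `𝒜`, the endomorphism ring
`Z(𝒜) := End(𝟙_𝒜)` of the unit object is a commutative ring which is von Neumann
regular (absolutely flat): every `a` admits an `x` with `a * x * a = a`.  In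
particular, if `End(𝟙_𝒜)` is an integral domain then it is a field. -/
theorem end_unit_commutative_vonNeumannRegular
    {𝒜 : Type*} [Category 𝒜] [Abelian 𝒜] [MonoidalCategory 𝒜]
    [SymmetricCategory 𝒜] [RigidCategory 𝒜] :
    (∀ a b : End (𝟙_ 𝒜), a * b = b * a) ∧
    (∀ a : End (𝟙_ 𝒜), ∃ x : End (𝟙_ 𝒜), a * x * a = a) ∧
    (IsDomain (End (𝟙_ 𝒜)) → IsField (End (𝟙_ 𝒜))) := by
  have hcomm (a b : End (𝟙_ 𝒜)) : a * b = b * a := end_unit_comp_comm b a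
  have hreg (a : End (𝟙_ 𝒜)) : ∃ x : End (𝟙_ 𝒜), a * x * a = a :=
    exists_comp_comp_eq_of_end_unit a
  refine ⟨hcomm, hreg, fun _ => ⟨exists_pair_ne _, hcomm, fun {a} ha => ?_⟩⟩
  obtain ⟨x, hx⟩ := hreg a
  exact ⟨x, mul_right_cancel₀ ha (by rw [hx, one_mul])⟩
end
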